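/- arXiv:1609.00710 — 2 statements merged into one kernel-verified Lean document; each statement's English description precedes it below -/
import Mathlib

section
/- For all μ ∈ ℝ, σ > 0, α ≠ 0, q ≠ 0 and a ≤ b in ℝ, writing v* = (v−μ)/σ, a* = (a−μ)/σ, b* = (b−μ)/σ: ∫_a^b Φ(αq − v*/α) · exp(−v* q + α²q²/2) dv = −(σ/q)·exp(α²q²/2)·[ Φ(αq − b*/α)·exp(−b* q) − Φ(αq − a*/α)·exp(−a* q) ] + (σ/q)·[ Φ(−b*/α) − Φ(−a*/α) ]. -/
open MeasureTheory Real Set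

/-- Standard normal CDF. -/
noncomputable def Phi (x : ℝ) : ℝ :=
  ∫ t in Set.Iic x, (Real.sqrt (2 * Real.pi))⁻¹ * Real.exp (-t ^ 2 / 2)

/-- The standard normal density is continuous. -/
theorem continuous_stdNormalDensity :
    Continuous fun t : ℝ => (Real.sqrt (2 * Real.pi))⁻¹ * Real.exp (-t ^ 2 / 2) := by
  fun_prop

/-- The standard normal density is integrable. -/
theorem integrable_stdNormalDensity :
    Integrable fun t : ℝ => (Real.sqrt (2 * Real.pi))⁻¹ * Real.exp (-t ^ 2 / 2) := by
  refine Integrable.const_mul ?_ _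
  refine (integrable_exp_neg_mul_sq (b := 1 / 2) (by norm_num)).congr (.of_forall fun t => ?_)
  dsimp only
  congr 1
  ring

/-- The derivative of the standard normal CDF is the standard normal density. -/
theorem hasDerivAt_Phi (x : ℝ) :
    HasDerivAt Phi ((Real.sqrt (2 * Real.pi))⁻¹ * Real.exp (-x ^ 2 / 2)) x := by
  have h := (continuous_stdNormalDensity.integral_hasStrictDerivAt 0 x).hasDerivAt.const_add (Phi 0)
  refine h.congr_of_eventuallyEq (.of_forall fun y => ?_)
  beta_reduce
  rw [← intervalIntegral.integral_Iic_sub_Iic integrable_stdNormalDensity.integrableOn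
    integrable_stdNormalDensity.integrableOn]
  simp only [Phi]
  ring

theorem continuous_Phi : Continuous Phi :=
  continuous_iff_continuousAt.2 fun x => (hasDerivAt_Phi x).continuousAt

/-- Completing the square in the product of a shifted Gaussian and an exponential. -/
theorem exp_complete_square {α : ℝ} (hα : α ≠ 0) (q s : ℝ) :
    Real.exp (α ^ 2 * q ^ 2 / 2) * Real.exp (-(α * q - s / α) ^ 2 / 2) * Real.exp (-(s * q)) =
      Real.exp (-(-(s / α)) ^ 2 / 2) := by
  rw [← Real.exp_add, ← Real.exp_add]
  congr 1
  field_simp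
  ring

/-- Integration-by-parts identity used for the third component of the GAL cdf. -/
theorem gal_cdf_component_three (μ σ α q a b : ℝ) (hσ : 0 < σ) (hα : α ≠ 0)
    (hq : q ≠ 0) (hab : a ≤ b) :
    (∫ v in a..b,
        Phi (α * q - (v - μ) / σ / α) *
          Real.exp (-(((v - μ) / σ) * q) + α ^ 2 * q ^ 2 / 2)) =
      -(σ / q) * Real.exp (α ^ 2 * q ^ 2 / 2) *
          (Phi (α * q - (b - μ) / σ / α) * Real.exp (-(((b - μ) / σ) * q)) -
            Phi (α * q - (a - μ) / σ / α) * Real.exp (-(((a - μ) / σ) * q))) +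
        (σ / q) * (Phi (-((b - μ) / σ / α)) - Phi (-((a - μ) / σ / α))) := by
  have key : ∀ v : ℝ, HasDerivAt
      (fun v => -(σ / q) * Real.exp (α ^ 2 * q ^ 2 / 2) *
          (Phi (α * q - (v - μ) / σ / α) * Real.exp (-(((v - μ) / σ) * q))) +
        (σ / q) * Phi (-((v - μ) / σ / α)))
      (Phi (α * q - (v - μ) / σ / α) *
        Real.exp (-(((v - μ) / σ) * q) + α ^ 2 * q ^ 2 / 2)) v := by
    intro v
    have hs : HasDerivAt (fun v : ℝ => (v - μ) / σ) (1 / σ) v :=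
      ((hasDerivAt_id v).sub_const μ).div_const σ
    have hshift := (hasDerivAt_Phi (α * q - (v - μ) / σ / α)).comp v
      ((hs.div_const α).const_sub (α * q))
    have hexp := (hs.mul_const q).neg.exp
    have hlast := (hasDerivAt_Phi (-((v - μ) / σ / α))).comp v (hs.div_const α).neg
    refine (((hshift.mul hexp).const_mul (-(σ / q) * Real.exp (α ^ 2 * q ^ 2 / 2))).add
      (hlast.const_mul (σ / q))).congr_deriv ?_
    have hsq := exp_complete_square hα q ((v - μ) / σ)
    simp only [Function.comp_apply, Pi.neg_apply]
    rw [← hsq, Real.exp_add]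
    have hσ' := hσ.ne'
    generalize (v - μ) / σ = s
    field_simp
    ring
  rw [intervalIntegral.integral_eq_sub_of_hasDerivAt (fun v _ => key v)]
  · ring
  · have := continuous_Phi
    exact Continuous.intervalIntegrable (by fun_prop) a b
end

section
/- For all μ ∈ ℝ, σ > 0, p ∈ (0,1), α > 0 and t < p/σ: ∫_μ^∞ exp(ty) · Φ( (y−μ)/(ασ) − αp ) · exp( −((y−μ)/σ)p + α²p²/2 ) dy = σ · [ exp(μt + α²p²/2) / (p − σt) ] · Φ(−αp) + σ · [ exp(μt + α²σ²t²/2) / (p − σt) ] · Φ(ασt). -/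
open MeasureTheory Real Set

open Filter Topology

/-- Standard normal density. -/
noncomputable def stdNormalPDF (x : ℝ) : ℝ :=
  (Real.sqrt (2 * Real.pi))⁻¹ * Real.exp (-x ^ 2 / 2)

theorem stdNormalPDF_eq_gaussianPDFReal :
    stdNormalPDF = ProbabilityTheory.gaussianPDFReal 0 1 := by
  funext x
  simp [stdNormalPDF, ProbabilityTheory.gaussianPDFReal]

theorem integrable_stdNormalPDF : Integrable stdNormalPDF := by
  rw [stdNormalPDF_eq_gaussianPDFReal]
  exact ProbabilityTheory.integrable_gaussianPDFReal 0 1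

theorem integral_stdNormalPDF : ∫ x, stdNormalPDF x = 1 := by
  rw [stdNormalPDF_eq_gaussianPDFReal]
  exact ProbabilityTheory.integral_gaussianPDFReal_eq_one 0 one_ne_zero

theorem continuous_stdNormalPDF : Continuous stdNormalPDF := by
  unfold stdNormalPDF
  fun_prop

theorem Phi_eq_integral_stdNormalPDF (x : ℝ) : Phi x = ∫ t in Iic x, stdNormalPDF t := rfl

theorem Phi_nonneg (x : ℝ) : 0 ≤ Phi x :=
  integral_nonneg fun t => by positivity

theorem Phi_eq_add_intervalIntegral (x : ℝ) :
    Phi x = Phi 0 + ∫ t in (0 : ℝ)..x, stdNormalPDF t := by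
  have h := intervalIntegral.integral_Iic_sub_Iic (a := 0) (b := x)
    integrable_stdNormalPDF.integrableOn integrable_stdNormalPDF.integrableOn
  rw [Phi_eq_integral_stdNormalPDF, Phi_eq_integral_stdNormalPDF, ← h]
  ring

theorem hasDerivAt_Phi_s10 (x : ℝ) : HasDerivAt Phi (stdNormalPDF x) x := by
  rw [funext Phi_eq_add_intervalIntegral]
  exact (continuous_stdNormalPDF.integral_hasStrictDerivAt 0 x).hasDerivAt.const_add _

theorem tendsto_Phi_atTop : Tendsto Phi atTop (𝓝 1) := by
  rw [funext Phi_eq_add_intervalIntegral, ← integral_stdNormalPDF,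
    ← intervalIntegral.integral_Iic_add_Ioi (b := (0 : ℝ))
      integrable_stdNormalPDF.integrableOn integrable_stdNormalPDF.integrableOn]
  exact (intervalIntegral_tendsto_integral_Ioi 0 integrable_stdNormalPDF.integrableOn
    tendsto_id).const_add _

theorem Phi_neg (x : ℝ) : Phi (-x) = 1 - Phi x := by
  have h := intervalIntegral.integral_Iic_add_Ioi (b := x)
    integrable_stdNormalPDF.integrableOn integrable_stdNormalPDF.integrableOn
  have h' := integral_comp_neg_Ioi x stdNormalPDF
  have h_even : ∀ t, stdNormalPDF (-t) = stdNormalPDF t := fun t => by simp [stdNormalPDF]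
  simp only [h_even] at h'
  rw [integral_stdNormalPDF] at h
  rw [Phi_eq_integral_stdNormalPDF, Phi_eq_integral_stdNormalPDF, ← h']
  linarith

theorem stdNormalPDF_add (w k : ℝ) :
    stdNormalPDF (w + k) = Real.exp (-(w * k) - k ^ 2 / 2) * stdNormalPDF w := by
  unfold stdNormalPDF
  rw [mul_left_comm, ← Real.exp_add]
  ring_nf

/-- The Laplace transform of a shifted and rescaled normal CDF on a half-line. -/
theorem integral_Ioi_exp_neg_mul_Phi {c s : ℝ} (hc : 0 < c) (hs : 0 < s) (m μ : ℝ) :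
    ∫ y in Ioi μ, Real.exp (-(c * (y - μ))) * Phi ((y - μ) / s - m) =
      (Phi (-m) + Real.exp ((c * s) ^ 2 / 2 - c * s * m) * Phi (m - c * s)) / c := by
  have h_affine (k y : ℝ) : HasDerivAt (fun y => (y - μ) / s - m + k) (1 / s) y :=
    ((((hasDerivAt_id y).sub_const μ).div_const s).sub_const m).add_const k
  have h_Phi (k y : ℝ) : HasDerivAt (fun y => Phi ((y - μ) / s - m + k))
      (stdNormalPDF ((y - μ) / s - m + k) * (1 / s)) y :=
    (hasDerivAt_Phi_s10 _).comp y (h_affine k y)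
  have h_exp (y : ℝ) : HasDerivAt (fun y => Real.exp (-(c * (y - μ))))
      (Real.exp (-(c * (y - μ))) * -(c * 1)) y :=
    ((((hasDerivAt_id y).sub_const μ).const_mul c).neg).exp
  have h_sub : Tendsto (fun y : ℝ => y - μ) atTop atTop :=
    tendsto_atTop_add_const_right _ (-μ) tendsto_id
  have h_Phi_lim (k : ℝ) : Tendsto (fun y => Phi ((y - μ) / s - m + k)) atTop (𝓝 1) :=
    tendsto_Phi_atTop.comp <| tendsto_atTop_add_const_right _ k <|
      tendsto_atTop_add_const_right _ (-m) <| h_sub.atTop_div_const hs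
  have h_exp_lim : Tendsto (fun y => Real.exp (-(c * (y - μ)))) atTop (𝓝 0) :=
    Real.tendsto_exp_neg_atTop_nhds_zero.comp (h_sub.const_mul_atTop hc)
  set E := Real.exp ((c * s) ^ 2 / 2 - c * s * m) with hE
  have h_deriv (y : ℝ) : HasDerivAt
      (fun y => (E * Phi ((y - μ) / s - m + c * s) -
        Real.exp (-(c * (y - μ))) * Phi ((y - μ) / s - m + 0)) / c)
      (Real.exp (-(c * (y - μ))) * Phi ((y - μ) / s - m)) y := by
    refine HasDerivAt.congr_deriv
      ((((h_Phi (c * s) y).const_mul E).sub ((h_exp y).mul (h_Phi 0 y))).div_const c) ?_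
    have h_mul : E * stdNormalPDF ((y - μ) / s - m + c * s) =
        Real.exp (-(c * (y - μ))) * stdNormalPDF ((y - μ) / s - m) := by
      rw [stdNormalPDF_add, hE, ← mul_assoc, ← Real.exp_add]
      congr 2
      field_simp
      ring
    rw [← mul_assoc E, h_mul, add_zero]
    field_simp
    ring
  rw [integral_Ioi_of_hasDerivAt_of_nonneg' (fun y _ => h_deriv y)
    (fun y _ => mul_nonneg (Real.exp_nonneg _) (Phi_nonneg _))
    ((((h_Phi_lim (c * s)).const_mul E).sub (h_exp_lim.mul (h_Phi_lim 0))).div_const c)]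
  have h_neg : Phi (-m + c * s) = 1 - Phi (m - c * s) := by
    rw [← Phi_neg, neg_sub, neg_add_eq_sub]
  simp only [sub_self, zero_div, zero_sub, mul_zero, neg_zero, Real.exp_zero, add_zero, h_neg]
  ring

/-- The first component integral M₁ in the derivation of the GAL mgf (α > 0). -/
theorem gal_mgf_M1 (μ σ p α t : ℝ) (hσ : 0 < σ) (hp : p ∈ Set.Ioo (0 : ℝ) 1)
    (hα : 0 < α) (ht : t < p / σ) :
    (∫ y in Set.Ioi μ,
        Real.exp (t * y) * Phi ((y - μ) / (α * σ) - α * p) *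
          Real.exp (-(((y - μ) / σ) * p) + α ^ 2 * p ^ 2 / 2)) =
      σ * (Real.exp (μ * t + α ^ 2 * p ^ 2 / 2) / (p - σ * t)) * Phi (-(α * p)) +
        σ * (Real.exp (μ * t + α ^ 2 * σ ^ 2 * t ^ 2 / 2) / (p - σ * t)) *
          Phi (α * σ * t) := by
  have hc : 0 < p / σ - t := sub_pos.mpr ht
  have h_integrand (y : ℝ) : Real.exp (t * y) * Phi ((y - μ) / (α * σ) - α * p) *
      Real.exp (-(((y - μ) / σ) * p) + α ^ 2 * p ^ 2 / 2) =
      Real.exp (μ * t + α ^ 2 * p ^ 2 / 2) *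
        (Real.exp (-((p / σ - t) * (y - μ))) * Phi ((y - μ) / (α * σ) - α * p)) := by
    rw [mul_right_comm, ← mul_assoc, ← Real.exp_add, ← Real.exp_add]
    congr 2
    ring
  have h_rate : (p / σ - t) * (α * σ) = α * p - α * σ * t := by
    field_simp
  have h_exp : Real.exp (μ * t + α ^ 2 * σ ^ 2 * t ^ 2 / 2) =
      Real.exp (μ * t + α ^ 2 * p ^ 2 / 2) *
        Real.exp ((α * p - α * σ * t) ^ 2 / 2 - (α * p - α * σ * t) * (α * p)) := by
    rw [← Real.exp_add]
    congr 1
    ring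
  have h_div : p - σ * t = σ * (p / σ - t) := by
    field_simp
  simp only [h_integrand]
  rw [integral_const_mul, integral_Ioi_exp_neg_mul_Phi hc (mul_pos hα hσ), h_rate, h_exp, h_div,
    sub_sub_cancel]
  generalize p / σ - t = c at hc
  field_simp
end
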